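/- For 0 < a < c ≤ 1, the function f(x) = μ_{a,c}(1/cosh(x)) is increasing and concave from (0,∞) onto (0,∞). Consequently, for all r, s ∈ (0,1), with r' = √(1-r²), s' = √(1-s²): μ_{a,c}(rs/(1+r's')) ≤ μ_{a,c}(r) + μ_{a,c}(s) ≤ 2·μ_{a,c}(√(2rs/(1+rs+r's'))) ≤ 2·μ_{a,c}(√(rs)), where the second inequality is an equality if and only if r = s. -/

import Mathlib

open Real Set

/-- Shifted factorial (Pochhammer/Appell symbol) `(a)ₙ`. -/
noncomputable def shiftedFact (a : ℝ) : ℕ → ℝ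
  | 0 => 1
  | n + 1 => shiftedFact a n * (a + n)

/-- Gaussian hypergeometric function `F(a,b;c;x)` as a series. -/
noncomputable def hypF (a b c x : ℝ) : ℝ :=
  ∑' n : ℕ, shiftedFact a n * shiftedFact b n / (shiftedFact c n * (Nat.factorial n : ℝ)) * x ^ n

/-- Generalized complete elliptic integral of the first kind `𝒦ₐ(r)`. -/
noncomputable def ellK (a r : ℝ) : ℝ := (Real.pi / 2) * hypF a (1 - a) 1 (r ^ 2)

/-- Generalized complete elliptic integral of the second kind `ℰₐ(r)`. -/
noncomputable def ellE (a r : ℝ) : ℝ := (Real.pi / 2) * hypF (a - 1) (1 - a) 1 (r ^ 2)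

/-- The generalized Grötzsch modulus `μₐ(r)`. -/
noncomputable def muFn (a r : ℝ) : ℝ :=
  Real.pi / (2 * Real.sin (Real.pi * a)) * ellK a (Real.sqrt (1 - r ^ 2)) / ellK a r

/-- Inverse of `μₐ` (on `(0,1)`, where it is a decreasing homeomorphism onto `(0,∞)`). -/
noncomputable def muInv (a : ℝ) : ℝ → ℝ := Function.invFunOn (muFn a) (Set.Ioo 0 1)

/-- The generalized modular function `φ_K^a(r)`. -/
noncomputable def phiK (a K r : ℝ) : ℝ := muInv a (muFn a r / K)

/-- `η_K^a(x) = (s/s')²` where `s = φ_K^a(√(x/(1+x)))`. -/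
noncomputable def etaK (a K x : ℝ) : ℝ :=
  ((phiK a K (Real.sqrt (x / (1 + x)))) / Real.sqrt (1 - (phiK a K (Real.sqrt (x / (1 + x)))) ^ 2)) ^ 2

/-- `λₐ(K)`. -/
noncomputable def lambdaA (a K : ℝ) : ℝ :=
  (phiK a K (1 / Real.sqrt 2) / phiK a (1 / K) (1 / Real.sqrt 2)) ^ 2

/-- The generalized inverse hyperbolic tangent `artanh_p`. -/
noncomputable def artanhp (p x : ℝ) : ℝ := ∫ t in (0:ℝ)..x, (1 - t ^ p)⁻¹

/-- The inverse hyperbolic tangent. -/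
noncomputable def artanh (x : ℝ) : ℝ := (1 / 2) * Real.log ((1 + x) / (1 - x))

/-- Euler beta function. -/
noncomputable def betaB (x y : ℝ) : ℝ := Real.Gamma x * Real.Gamma y / Real.Gamma (x + y)

/-- `μ_{a,c}(r)`, the two-parameter generalized modulus. -/
noncomputable def muAC (a c r : ℝ) : ℝ :=
  betaB a (c - a) * hypF a (c - a) c (1 - r ^ 2) / (2 * hypF a (c - a) c (r ^ 2))

/-- Inverse of `μ_{a,c}` on `(0,1)`. -/
noncomputable def muACInv (a c : ℝ) : ℝ → ℝ := Function.invFunOn (muAC a c) (Set.Ioo 0 1)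

/-- The modular function `φ_K^{a,c}(r)`. -/
noncomputable def phiAC (a c K r : ℝ) : ℝ := muACInv a c (muAC a c r / K)


noncomputable def PSs (p : ℕ → ℝ) (x : ℝ) : ℝ := ∑' n : ℕ, p n * x ^ n

lemma PSs_summable (p : ℕ → ℝ) (hp : ∀ n, |p n| ≤ 1) (x : ℝ) (hx : |x| < 1) :
    Summable (fun n => p n * x ^ n) := by
  refine Summable.of_norm_bounded (g := fun n => |x| ^ n)
    (summable_geometric_of_lt_one (abs_nonneg x) hx) ?_
  intro n
  rw [norm_mul, norm_pow, Real.norm_eq_abs, Real.norm_eq_abs]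
  exact mul_le_of_le_one_left (by positivity) (hp n)

lemma PSs_summable' (p : ℕ → ℝ) (hp : ∀ n, |p n| ≤ 1) (x : ℝ) (hx : |x| < 1) :
    Summable (fun n => p n * ((n:ℝ) * x ^ (n - 1))) := by
  have h : Summable (fun n : ℕ => (n:ℝ) * |x| ^ (n - 1)) := by
    rw [← summable_nat_add_iff 1]
    have h1 := (summable_pow_mul_geometric_of_norm_lt_one (R := ℝ) 1 (r := |x|) (by simpa using hx))
    have h2 := summable_geometric_of_lt_one (abs_nonneg x) hx
    refine (h1.add h2).congr ?_
    intro n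
    simp
    ring
  refine Summable.of_norm_bounded h ?_
  intro n
  rw [norm_mul, norm_mul, norm_pow, Real.norm_eq_abs, Real.norm_eq_abs, Real.norm_eq_abs, Nat.abs_cast]
  exact mul_le_of_le_one_left (by positivity) (hp n)

lemma PSs_hasDeriv (p : ℕ → ℝ) (hp : ∀ n, |p n| ≤ 1) (x : ℝ) (hx : |x| < 1) :
    HasDerivAt (PSs p) (∑' n : ℕ, p n * ((n:ℝ) * x ^ (n - 1))) x := by
  obtain ⟨ρ, h1, h2⟩ := exists_between hx
  have hρ0 : 0 < ρ := lt_of_le_of_lt (abs_nonneg x) h1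
  have hs : Summable (fun n : ℕ => (n:ℝ) * ρ ^ (n - 1)) := by
    have := PSs_summable' (fun _ => 1) (by simp) ρ (by rwa [abs_of_pos hρ0])
    simpa using this
  refine hasDerivAt_tsum_of_isPreconnected (t := Metric.ball 0 ρ) (y₀ := 0)
    (g := fun n y => p n * y ^ n) (g' := fun n y => p n * ((n:ℝ) * y ^ (n - 1))) hs
    Metric.isOpen_ball (convex_ball _ _).isPreconnected ?_ ?_ ?_ ?_ ?_
  · intro n y _
    exact (hasDerivAt_pow n y).const_mul _
  · intro n y hy
    have hy' : |y| ≤ ρ := by simpa using (Metric.mem_ball.1 hy).le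
    rw [norm_mul, norm_mul, norm_pow, Real.norm_eq_abs, Real.norm_eq_abs, Real.norm_eq_abs,
      Nat.abs_cast]
    refine (mul_le_of_le_one_left (by positivity) (hp n)).trans ?_
    gcongr
  · simpa using hρ0
  · exact PSs_summable p hp 0 (by simp)
  · simpa using h1

/-- monotone quotient -/
lemma PSs_quot (p q : ℕ → ℝ) (x y : ℝ)
    (hpx : Summable (fun n => p n * x ^ n)) (hpy : Summable (fun n => p n * y ^ n))
    (hqx : Summable (fun n => q n * x ^ n)) (hqy : Summable (fun n => q n * y ^ n))
    (h : ∀ n m, n ≤ m → p n * q m ≤ p m * q n) (hx : 0 ≤ x) (hxy : x ≤ y) :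
    PSs p x * PSs q y ≤ PSs p y * PSs q x := by
  have t1 := (hpx.hasSum.tendsto_sum_nat).mul (hqy.hasSum.tendsto_sum_nat)
  have t2 := (hpy.hasSum.tendsto_sum_nat).mul (hqx.hasSum.tendsto_sum_nat)
  refine le_of_tendsto_of_tendsto' t1 t2 ?_
  intro N
  have e : ∀ n m : ℕ, 0 ≤ (p n * q m - p m * q n) * (y ^ n * x ^ m - x ^ n * y ^ m) := by
    have key : ∀ n m : ℕ, n ≤ m → x ^ m * y ^ n ≤ x ^ n * y ^ m := by
      intro n m hnm
      obtain ⟨k, rfl⟩ := Nat.exists_eq_add_of_le hnm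
      rw [pow_add, pow_add]
      have h3 : x ^ k ≤ y ^ k := pow_le_pow_left₀ hx hxy k
      have h4 : 0 ≤ x ^ n * y ^ n := by have := hx.trans hxy; positivity
      nlinarith
    intro n m
    rcases le_total n m with hnm | hnm
    · have h1 := h n m hnm
      have h2 := key n m hnm
      apply mul_nonneg_of_nonpos_of_nonpos <;> linarith
    · have h1 := h m n hnm
      have h2 := key m n hnm
      apply mul_nonneg <;> linarith
  rw [Finset.sum_mul_sum, Finset.sum_mul_sum]
  have e2 : 0 ≤ ∑ n ∈ Finset.range N, ∑ m ∈ Finset.range N,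
      (p n * q m - p m * q n) * (y ^ n * x ^ m - x ^ n * y ^ m) :=
    Finset.sum_nonneg fun n _ => Finset.sum_nonneg fun m _ => e n m
  have e3 : ∑ n ∈ Finset.range N, ∑ m ∈ Finset.range N,
      (p n * q m - p m * q n) * (y ^ n * x ^ m - x ^ n * y ^ m) =
      (∑ n ∈ Finset.range N, ∑ m ∈ Finset.range N, p n * y ^ n * (q m * x ^ m)
      - ∑ n ∈ Finset.range N, ∑ m ∈ Finset.range N, p n * x ^ n * (q m * y ^ m))
      + (∑ n ∈ Finset.range N, ∑ m ∈ Finset.range N, p m * y ^ m * (q n * x ^ n)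
      - ∑ n ∈ Finset.range N, ∑ m ∈ Finset.range N, p m * x ^ m * (q n * y ^ n)) := by
    rw [← Finset.sum_sub_distrib, ← Finset.sum_sub_distrib, ← Finset.sum_add_distrib]
    refine Finset.sum_congr rfl fun n _ => ?_
    rw [← Finset.sum_sub_distrib, ← Finset.sum_sub_distrib, ← Finset.sum_add_distrib]
    refine Finset.sum_congr rfl fun m _ => ?_
    ring
  have s1 : ∑ n ∈ Finset.range N, ∑ m ∈ Finset.range N, p m * y ^ m * (q n * x ^ n) =
      ∑ n ∈ Finset.range N, ∑ m ∈ Finset.range N, p n * y ^ n * (q m * x ^ m) := Finset.sum_comm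
  have s2 : ∑ n ∈ Finset.range N, ∑ m ∈ Finset.range N, p m * x ^ m * (q n * y ^ n) =
      ∑ n ∈ Finset.range N, ∑ m ∈ Finset.range N, p n * x ^ n * (q m * y ^ m) := Finset.sum_comm
  linarith

noncomputable def cA (a c : ℝ) (n : ℕ) : ℝ :=
  shiftedFact a n * shiftedFact (c - a) n / (shiftedFact c n * (Nat.factorial n : ℝ))

noncomputable def cQ (a c : ℝ) (n : ℕ) : ℝ := cA a c n * (a * (c - a) / (n + c))

lemma sF_pos (a : ℝ) (ha : 0 < a) (n : ℕ) : 0 < shiftedFact a n := by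
  induction n with
  | zero => simp [shiftedFact]
  | succ n ih => rw [shiftedFact]; positivity

lemma cA_zero (a c : ℝ) : cA a c 0 = 1 := by simp [cA, shiftedFact]

section
variable {a c : ℝ} (ha : 0 < a) (hac : a < c) (hc : c ≤ 1)

lemma cA_pos (ha : 0 < a) (hac : a < c) (n : ℕ) : 0 < cA a c n := by
  have h1 := sF_pos a ha n
  have h2 := sF_pos (c - a) (by linarith) n
  have h3 := sF_pos c (by linarith) n
  unfold cA
  positivity

lemma cA_succ (ha : 0 < a) (hac : a < c) (n : ℕ) :
    cA a c (n+1) * (n + 1) * (n + c) = cA a c n * ((n + a) * (n + (c - a))) := by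
  have h3 := sF_pos c (by linarith) n
  have h4 : 0 < c + n := by have : (0:ℝ) ≤ n := by positivity
                            linarith
  unfold cA
  simp only [shiftedFact, Nat.factorial_succ]
  push_cast
  field_simp
  ring

lemma ab_le (a c : ℝ) : 4 * (a * (c - a)) ≤ c ^ 2 := by nlinarith [sq_nonneg (2 * a - c)]

lemma cA_le (ha : 0 < a) (hac : a < c) (hc : c ≤ 1) (n : ℕ) : cA a c n ≤ 1 := by
  induction n with
  | zero => rw [cA_zero]
  | succ n ih =>
    have h := cA_succ ha hac n
    have h0 := cA_pos ha hac n
    have hn : (0:ℝ) ≤ n := by positivity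
    have hk : ((n:ℝ) + a) * (n + (c - a)) ≤ (n + 1) * (n + c) := by nlinarith [ab_le a c]
    have hp : 0 < ((n:ℝ) + 1) * (n + c) := by have : 0 < c := by linarith
                                              positivity
    have : cA a c (n+1) * ((n + 1) * (n + c)) ≤ 1 * ((n + 1) * (n + c)) := by
      calc _ = cA a c n * ((n + a) * (n + (c - a))) := by rw [← h]; ring
        _ ≤ cA a c n * ((n + 1) * (n + c)) := by gcongr
        _ ≤ _ := by gcongr
    exact le_of_mul_le_mul_right this hp

lemma cA_abs (ha : 0 < a) (hac : a < c) (hc : c ≤ 1) (n : ℕ) : |cA a c n| ≤ 1 := by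
  rw [abs_of_pos (cA_pos ha hac n)]; exact cA_le ha hac hc n

lemma cQ_pos (ha : 0 < a) (hac : a < c) (n : ℕ) : 0 < cQ a c n := by
  have := cA_pos ha hac n
  have h1 : 0 < c := by linarith
  have h2 : 0 < c - a := by linarith
  unfold cQ; positivity

lemma cQ_le (ha : 0 < a) (hac : a < c) (n : ℕ) : 4 * cQ a c n ≤ c * cA a c n := by
  have := cA_pos ha hac n
  have h1 : 0 < c := by linarith
  have h3 : 4 * (a * (c - a) / (n + c)) ≤ c := by
    rw [← mul_div_assoc, div_le_iff₀ (by positivity)]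
    have : (0:ℝ) ≤ c * n := by positivity
    nlinarith [ab_le a c]
  unfold cQ; nlinarith

lemma cQ_lt (ha : 0 < a) (hac : a < c) : 4 * cQ a c 1 < c * cA a c 1 := by
  have := cA_pos ha hac 1
  have h1 : 0 < c := by linarith
  have h3 : 4 * (a * (c - a) / ((1:ℕ) + c)) < c := by
    rw [← mul_div_assoc, div_lt_iff₀ (by positivity)]
    push_cast
    nlinarith [ab_le a c]
  unfold cQ; nlinarith

lemma cQ_abs (ha : 0 < a) (hac : a < c) (hc : c ≤ 1) (n : ℕ) : |cQ a c n| ≤ 1 := by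
  rw [abs_of_pos (cQ_pos ha hac n)]
  have := cQ_le ha hac n
  have := cA_le ha hac hc n
  have := cA_pos ha hac n
  nlinarith

lemma cA_lower (ha : 0 < a) (hac : a < c) (n : ℕ) :
    a * (c - a) / c ≤ cA a c (n + 1) * (n + 1) := by
  have hcp : 0 < c := by linarith
  induction n with
  | zero =>
    have h := cA_succ ha hac 0
    rw [cA_zero] at h
    push_cast at h ⊢
    rw [div_le_iff₀ hcp]
    nlinarith
  | succ n ih =>
    have h := cA_succ ha hac (n+1)
    have h0 := cA_pos ha hac (n+1)
    push_cast at h ⊢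
    refine ih.trans ?_
    have hp : 0 < (n:ℝ) + 1 + c := by positivity
    refine le_of_mul_le_mul_right ?_ hp
    rw [h]
    have : (0:ℝ) < a * (c - a) := mul_pos ha (by linarith)
    have hn : (0:ℝ) ≤ n := by positivity
    rw [mul_assoc]
    refine mul_le_mul_of_nonneg_left ?_ h0.le
    nlinarith

noncomputable def fF (a c x : ℝ) : ℝ := PSs (cA a c) x
noncomputable def fQ (a c x : ℝ) : ℝ := PSs (cQ a c) x

lemma hypF_eq (a c x : ℝ) : hypF a (c - a) c x = fF a c x := rfl

lemma fF_hasDeriv (ha : 0 < a) (hac : a < c) (hc : c ≤ 1) (x : ℝ) (hx : |x| < 1) :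
    HasDerivAt (fF a c) (fQ a c x / (1 - x)) x := by
  have h := PSs_hasDeriv (cA a c) (cA_abs ha hac hc) x hx
  show HasDerivAt (PSs (cA a c)) _ x
  have hs := PSs_summable' (cA a c) (cA_abs ha hac hc) x hx
  convert h using 1
  have hx1 : 1 - x ≠ 0 := by have := (abs_lt.1 hx).2; linarith
  rw [div_eq_iff hx1]
  have e1 : ∑' n : ℕ, cA a c n * ((n:ℝ) * x ^ (n - 1))
      = ∑' n : ℕ, cA a c (n+1) * (((n:ℝ) + 1) * x ^ n) := by
    rw [hs.tsum_eq_zero_add]; simp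
  have hs1 : Summable (fun n : ℕ => cA a c (n+1) * (((n:ℝ) + 1) * x ^ n)) := by
    have := (summable_nat_add_iff 1).2 hs
    simpa using this
  have e2 : (∑' n : ℕ, cA a c n * ((n:ℝ) * x ^ (n - 1))) * x
      = ∑' n : ℕ, cA a c n * ((n:ℝ) * x ^ (n - 1)) * x := by rw [tsum_mul_right]
  rw [mul_sub, mul_one, e2, e1, ← hs1.tsum_sub (hs.mul_right x)]
  unfold fQ PSs
  congr 1
  ext n
  have e3 : (n:ℝ) * x ^ (n-1) * x = n * x ^ n := by
    cases n with
    | zero => simp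
    | succ n => simp [pow_succ, mul_assoc]
  rw [mul_assoc _ _ x, e3]
  have h := cA_succ ha hac n
  have hp : (0:ℝ) < n + c := by have : 0 < c := by linarith
                                positivity
  have : cA a c (n+1) * ((n:ℝ) + 1) = cA a c n * ((n + a) * (n + (c - a))) / (n + c) := by
    rw [eq_div_iff hp.ne']; exact h
  rw [← mul_assoc, this]
  unfold cQ
  field_simp
  ring

lemma fQ_hasDeriv (ha : 0 < a) (hac : a < c) (hc : c ≤ 1) (x : ℝ) (hx : |x| < 1) (hx0 : x ≠ 0) :
    HasDerivAt (fQ a c) ((a * (c - a) * fF a c x - c * fQ a c x) / x) x := by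
  have h := PSs_hasDeriv (cQ a c) (cQ_abs ha hac hc) x hx
  show HasDerivAt (PSs (cQ a c)) _ x
  have hs := PSs_summable' (cQ a c) (cQ_abs ha hac hc) x hx
  have hF := PSs_summable (cA a c) (cA_abs ha hac hc) x hx
  have hQ := PSs_summable (cQ a c) (cQ_abs ha hac hc) x hx
  convert h using 1
  rw [div_eq_iff hx0, ← tsum_mul_right]
  unfold fF fQ PSs
  rw [← tsum_mul_left, ← tsum_mul_left, ← (hF.mul_left _).tsum_sub (hQ.mul_left _)]
  congr 1
  ext n
  have e3 : (n:ℝ) * x ^ (n-1) * x = n * x ^ n := by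
    cases n with
    | zero => simp
    | succ n => simp [pow_succ, mul_assoc]
  rw [mul_assoc _ _ x, e3]
  have hp : (0:ℝ) < n + c := by have : 0 < c := by linarith
                                positivity
  unfold cQ
  field_simp
  ring

lemma abs_lt_of {x : ℝ} (h0 : 0 ≤ x) (h1 : x < 1) : |x| < 1 := by rwa [abs_of_nonneg h0]

lemma fF_ge (ha : 0 < a) (hac : a < c) (hc : c ≤ 1) {x : ℝ} (h0 : 0 ≤ x) (h1 : x < 1) :
    1 ≤ fF a c x := by
  have hF := PSs_summable (cA a c) (cA_abs ha hac hc) x (abs_lt_of h0 h1)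
  have := hF.le_tsum 0 (fun n _ => by have := cA_pos ha hac n; positivity)
  simpa [cA_zero, fF, PSs] using this

lemma fF_zero : fF a c 0 = 1 := by
  unfold fF PSs
  rw [tsum_eq_single 0]
  · simp [cA_zero]
  · intro n hn; simp [hn]

lemma fQ_pos (ha : 0 < a) (hac : a < c) (hc : c ≤ 1) {x : ℝ} (h0 : 0 ≤ x) (h1 : x < 1) :
    0 < fQ a c x := by
  have hF := PSs_summable (cQ a c) (cQ_abs ha hac hc) x (abs_lt_of h0 h1)
  refine hF.tsum_pos (fun n => by have := cQ_pos ha hac n; positivity) 0 ?_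
  simpa using cQ_pos ha hac 0

lemma fQ_lt (ha : 0 < a) (hac : a < c) (hc : c ≤ 1) {x : ℝ} (h0 : 0 < x) (h1 : x < 1) :
    4 * fQ a c x < c * fF a c x := by
  have hF := PSs_summable (cA a c) (cA_abs ha hac hc) x (abs_lt_of h0.le h1)
  have hQ := PSs_summable (cQ a c) (cQ_abs ha hac hc) x (abs_lt_of h0.le h1)
  unfold fF fQ PSs
  rw [← tsum_mul_left, ← tsum_mul_left]
  refine Summable.tsum_lt_tsum (i := 1) ?_ ?_ (hQ.mul_left _) (hF.mul_left _)
  · intro n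
    have := cQ_le ha hac n
    have : 0 < x ^ n := by positivity
    nlinarith
  · have := cQ_lt ha hac
    simp only [pow_one]
    nlinarith

lemma fF_log (ha : 0 < a) (hac : a < c) (hc : c ≤ 1) {x : ℝ} (h0 : 0 ≤ x) (h1 : x < 1) :
    a * (c - a) / c * (- Real.log (1 - x)) ≤ fF a c x := by
  have hF := PSs_summable (cA a c) (cA_abs ha hac hc) x (abs_lt_of h0 h1)
  have hl := (Real.hasSum_pow_div_log_of_abs_lt_one (abs_lt_of h0 h1)).mul_left (a * (c - a) / c)
  unfold fF PSs
  rw [hF.tsum_eq_zero_add, ← hl.tsum_eq]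
  have := hl.summable.tsum_le_tsum (g := fun n => cA a c (n+1) * x ^ (n+1)) ?_
    ((summable_nat_add_iff 1).2 hF)
  · rw [cA_zero]; simp only [pow_zero]; linarith
  · intro n
    have h := cA_lower ha hac n
    rw [mul_div_assoc', div_le_iff₀ (by positivity)]
    have : 0 ≤ x ^ (n+1) := by positivity
    nlinarith

/-- q/F decreasing -/
lemma quot1 (ha : 0 < a) (hac : a < c) (hc : c ≤ 1) {x y : ℝ} (h0 : 0 ≤ x) (hxy : x ≤ y)
    (h1 : y < 1) : fQ a c y * fF a c x ≤ fQ a c x * fF a c y := by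
  have hx := abs_lt_of h0 (hxy.trans_lt h1)
  have hy := abs_lt_of (h0.trans hxy) h1
  have := PSs_quot (cA a c) (cQ a c) x y (PSs_summable _ (cA_abs ha hac hc) x hx)
    (PSs_summable _ (cA_abs ha hac hc) y hy) (PSs_summable _ (cQ_abs ha hac hc) x hx)
    (PSs_summable _ (cQ_abs ha hac hc) y hy) ?_ h0 hxy
  · unfold fQ fF; linarith
  · intro n m hnm
    have h3 := cA_pos ha hac n
    have h4 := cA_pos ha hac m
    have h5 : 0 < c := by linarith
    have h6 : 0 < a * (c - a) := mul_pos ha (by linarith)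
    have h7 : (n:ℝ) ≤ m := by exact_mod_cast hnm
    have : a * (c - a) / ((m:ℝ) + c) ≤ a * (c - a) / (n + c) := by gcongr
    unfold cQ
    have : 0 < cA a c n * cA a c m := by positivity
    nlinarith

/-- the derivative quotient F'/F is increasing -/
lemma quot2 (ha : 0 < a) (hac : a < c) (hc : c ≤ 1) {x y : ℝ} (h0 : 0 ≤ x) (hxy : x ≤ y)
    (h1 : y < 1) : fQ a c x * fF a c y * (1 - y) ≤ fQ a c y * fF a c x * (1 - x) := by
  have hx := abs_lt_of h0 (hxy.trans_lt h1)
  have hy := abs_lt_of (h0.trans hxy) h1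
  have hd : ∀ z : ℝ, |z| < 1 → Summable (fun n : ℕ => cA a c (n+1) * ((n:ℝ) + 1) * z ^ n) ∧
      PSs (fun n : ℕ => cA a c (n+1) * ((n:ℝ) + 1)) z = fQ a c z / (1 - z) := by
    intro z hz
    have hs := PSs_summable' (cA a c) (cA_abs ha hac hc) z hz
    have h := PSs_hasDeriv (cA a c) (cA_abs ha hac hc) z hz
    have h' := fF_hasDeriv ha hac hc z hz
    have e := h'.unique h
    constructor
    · have := (summable_nat_add_iff 1).2 hs
      simpa [mul_assoc] using this
    · rw [e, hs.tsum_eq_zero_add]; simp [PSs, mul_assoc]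
  have := PSs_quot (fun n : ℕ => cA a c (n+1) * ((n:ℝ) + 1)) (cA a c) x y (hd x hx).1 (hd y hy).1
    (PSs_summable _ (cA_abs ha hac hc) x hx)
    (PSs_summable _ (cA_abs ha hac hc) y hy) ?_ h0 hxy
  · rw [(hd x hx).2, (hd y hy).2] at this
    have hy1 : 0 < 1 - y := by linarith
    have hx1 : 0 < 1 - x := by linarith
    rw [div_mul_eq_mul_div, div_mul_eq_mul_div, div_le_div_iff₀ hx1 hy1] at this
    exact this
  · have hmono : Monotone (fun n : ℕ => ((n:ℝ) + a) * (n + (c - a)) / (n + c)) := by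
      refine monotone_nat_of_le_succ fun n => ?_
      have h5 : 0 < c := by linarith
      have hn : (0:ℝ) ≤ n := by positivity
      have h6 : 0 < a * (c - a) := mul_pos ha (by linarith)
      rw [div_le_div_iff₀ (by positivity) (by positivity)]
      push_cast
      nlinarith [ab_le a c, mul_nonneg hn h5.le, mul_nonneg hn hn]
    intro n m hnm
    have h3 := cA_pos ha hac n
    have h4 := cA_pos ha hac m
    have e : ∀ n : ℕ, cA a c (n+1) * ((n:ℝ) + 1) =
        cA a c n * (((n:ℝ) + a) * (n + (c - a)) / (n + c)) := by
      intro n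
      have h5 : 0 < c := by linarith
      have hp : (0:ℝ) < n + c := by positivity
      rw [← mul_div_assoc, eq_div_iff hp.ne']
      exact cA_succ ha hac n
    have h8 := hmono hnm
    simp only at h8
    show cA a c (n+1) * ((n:ℝ) + 1) * cA a c m ≤ cA a c (m+1) * ((m:ℝ) + 1) * cA a c n
    rw [e, e]
    have : 0 < cA a c n * cA a c m := by positivity
    nlinarith
end

noncomputable def fN (a c u : ℝ) : ℝ :=
  (1 - u) * fQ a c (1 - u) * fF a c u + u * fF a c (1 - u) * fQ a c u

noncomputable def fH (a c u : ℝ) : ℝ := fN a c u / (√(1 - u) * fF a c u ^ 2)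

section
variable {a c : ℝ}

lemma fN_pos (ha : 0 < a) (hac : a < c) (hc : c ≤ 1) {u : ℝ} (h0 : 0 < u) (h1 : u < 1) :
    0 < fN a c u := by
  have q1 := fQ_pos ha hac hc h0.le h1
  have q2 := fQ_pos ha hac hc (x := 1 - u) (by linarith) (by linarith)
  have f1 := fF_ge ha hac hc h0.le h1
  have f2 := fF_ge ha hac hc (x := 1 - u) (by linarith) (by linarith)
  have : 0 < 1 - u := by linarith
  have : 0 < fF a c u := by linarith
  have : 0 < fF a c (1 - u) := by linarith
  unfold fN; positivity

lemma fN_hasDeriv (ha : 0 < a) (hac : a < c) (hc : c ≤ 1) {u : ℝ} (h0 : 0 < u) (h1 : u < 1) :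
    HasDerivAt (fN a c)
      ((1 - c) * (fQ a c u * fF a c (1 - u) - fQ a c (1 - u) * fF a c u)) u := by
  have hu := abs_lt_of h0.le h1
  have hv := abs_lt_of (x := 1 - u) (by linarith) (by linarith)
  have d1 : HasDerivAt (fun u : ℝ => 1 - u) (-1) u := by
    simpa using (hasDerivAt_id u).const_sub 1
  have dF := fF_hasDeriv ha hac hc u hu
  have dQ := fQ_hasDeriv ha hac hc u hu h0.ne'
  have dF' := (fF_hasDeriv ha hac hc (1 - u) hv).comp u d1
  have dQ' := (fQ_hasDeriv ha hac hc (1 - u) hv (by linarith)).comp u d1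
  have := ((d1.mul dQ').mul dF).add (((hasDerivAt_id u).mul dF').mul dQ)
  refine this.congr_deriv ?_
  have e0 : u ≠ 0 := h0.ne'
  have e1 : 1 - u ≠ 0 := by linarith
  simp only [Function.comp, id, Pi.mul_apply, sub_sub_cancel]
  field_simp
  ring

lemma key_ineq (ha : 0 < a) (hac : a < c) (hc : c ≤ 1) {u : ℝ} (h0 : 0 < u) (h1 : u < 1) :
    0 < (1 - c) * (1 - u) * (fQ a c u * fF a c (1 - u) - fQ a c (1 - u) * fF a c u) * fF a c u
      + fN a c u * (fF a c u / 2 - 2 * fQ a c u) := by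
  have q1 := fQ_pos ha hac hc h0.le h1
  have q2 := fQ_pos ha hac hc (x := 1 - u) (by linarith) (by linarith)
  have f1 := fF_ge ha hac hc h0.le h1
  have f2 := fF_ge ha hac hc (x := 1 - u) (by linarith) (by linarith)
  have hN := fN_pos ha hac hc h0 h1
  have hq := fQ_lt ha hac hc h0 h1
  have h3 : (1 - c) * fF a c u / 2 < fF a c u / 2 - 2 * fQ a c u := by linarith
  have h4 : fN a c u * ((1 - c) * fF a c u / 2) < fN a c u * (fF a c u / 2 - 2 * fQ a c u) :=
    mul_lt_mul_of_pos_left h3 hN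
  have br : (1 - u) * fQ a c (1 - u) * fF a c u ≤ (2 - u) * (fQ a c u * fF a c (1 - u)) := by
    have hP : 0 < fQ a c u * fF a c (1 - u) := by
      have : 0 < fF a c (1 - u) := by linarith
      positivity
    rcases le_total u (1 - u) with h | h
    · have := quot1 ha hac hc h0.le h (by linarith)
      have : (1 - u) * (fQ a c (1 - u) * fF a c u) ≤ (1 - u) * (fQ a c u * fF a c (1 - u)) :=
        mul_le_mul_of_nonneg_left this (by linarith)
      nlinarith
    · have := quot2 ha hac hc (by linarith) h h1
      nlinarith
  have h5 : 0 ≤ (1 - c) * fF a c u / 2 := by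
    have : 0 ≤ 1 - c := by linarith
    have : 0 ≤ fF a c u := by linarith
    positivity
  have h6 := mul_nonneg h5 (sub_nonneg.2 br)
  unfold fN at h4 ⊢
  nlinarith

lemma fH_hasDeriv (ha : 0 < a) (hac : a < c) (hc : c ≤ 1) {u : ℝ} (h0 : 0 < u) (h1 : u < 1) :
    ∃ d, 0 < d ∧ HasDerivAt (fH a c) d u := by
  have hu := abs_lt_of h0.le h1
  have f1 := fF_ge ha hac hc h0.le h1
  have hf : 0 < fF a c u := by linarith
  have hv : 0 < 1 - u := by linarith
  have d1 : HasDerivAt (fun u : ℝ => 1 - u) (-1) u := by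
    simpa using (hasDerivAt_id u).const_sub 1
  have ds := d1.sqrt hv.ne'
  have dF := (fF_hasDeriv ha hac hc u hu).pow 2
  have hs : 0 < √(1 - u) := Real.sqrt_pos.2 hv
  have := (fN_hasDeriv ha hac hc h0 h1).div (ds.mul dF) (by simp only [Pi.mul_apply, Pi.pow_apply]; positivity)
  refine ⟨_, ?_, this⟩
  simp only [Pi.mul_apply, Pi.pow_apply]
  refine div_pos ?_ (by positivity)
  have k := key_ineq ha hac hc h0 h1
  have hss : √(1 - u) ^ 2 = 1 - u := Real.sq_sqrt hv.le
  set S := √(1 - u) with hS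
  clear_value S
  have k2 : 0 < ((1 - c) * (1 - u) * (fQ a c u * fF a c (1 - u) - fQ a c (1 - u) * fF a c u) * fF a c u
      + fN a c u * (fF a c u / 2 - 2 * fQ a c u)) * (fF a c u / S) := by positivity
  refine k2.trans_le (le_of_eq ?_)
  have hu2 : u = 1 - S ^ 2 := by linarith
  rw [← hss]
  push_cast
  field_simp
  ring

lemma fH_strictMono (ha : 0 < a) (hac : a < c) (hc : c ≤ 1) :
    StrictMonoOn (fH a c) (Set.Ioo 0 1) := by
  refine strictMonoOn_of_deriv_pos (convex_Ioo _ _) ?_ ?_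
  · intro u hu
    obtain ⟨d, _, hd⟩ := fH_hasDeriv ha hac hc hu.1 hu.2
    exact hd.continuousAt.continuousWithinAt
  · rw [interior_Ioo]
    intro u hu
    obtain ⟨d, h, hd⟩ := fH_hasDeriv ha hac hc hu.1 hu.2
    rwa [hd.deriv]

lemma betaB_pos (ha : 0 < a) (hac : a < c) : 0 < betaB a (c - a) := by
  have h1 := Real.Gamma_pos_of_pos ha
  have h2 := Real.Gamma_pos_of_pos (sub_pos.2 hac)
  have h3 : 0 < Real.Gamma (a + (c - a)) := Real.Gamma_pos_of_pos (by linarith)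
  unfold betaB; positivity

lemma sech_mem {x : ℝ} (hx : 0 < x) : (1 / Real.cosh x) ^ 2 ∈ Set.Ioo (0:ℝ) 1 := by
  have h1 : 1 < Real.cosh x := Real.one_lt_cosh.2 hx.ne'
  have h2 : 0 < Real.cosh x := by linarith
  constructor
  · positivity
  · rw [div_pow, one_pow, div_lt_one (by positivity)]; nlinarith

noncomputable def ff (a c x : ℝ) : ℝ := muAC a c (1 / Real.cosh x)

lemma ff_eq (a c x : ℝ) : ff a c x = betaB a (c - a) / 2 *
    (fF a c (1 - (1 / Real.cosh x) ^ 2) / fF a c ((1 / Real.cosh x) ^ 2)) := by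
  unfold ff muAC
  rw [hypF_eq, hypF_eq, mul_div_mul_comm]

lemma ff_hasDeriv (ha : 0 < a) (hac : a < c) (hc : c ≤ 1) {x : ℝ} (hx : 0 < x) :
    HasDerivAt (ff a c) (betaB a (c - a) * fH a c ((1 / Real.cosh x) ^ 2)) x := by
  have hm := sech_mem hx
  have hcosh : 0 < Real.cosh x := Real.cosh_pos x
  have hsinh : 0 < Real.sinh x := Real.sinh_pos_iff.2 hx
  have du : HasDerivAt (fun x => (1 / Real.cosh x) ^ 2) (-2 * Real.sinh x / Real.cosh x ^ 3) x := by
    have := (((hasDerivAt_const x (1:ℝ)).div (Real.hasDerivAt_cosh x) hcosh.ne').pow 2)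
    refine this.congr_deriv ?_
    simp only [Pi.div_apply]
    push_cast
    field_simp
    ring
  have hsq : √(1 - (1 / Real.cosh x) ^ 2) = Real.sinh x / Real.cosh x := by
    rw [show 1 - (1 / Real.cosh x) ^ 2 = (Real.sinh x / Real.cosh x) ^ 2 by
      have := Real.cosh_sq x
      field_simp
      linarith]
    exact Real.sqrt_sq (by positivity)
  have hsq2 : Real.cosh x ^ 2 = Real.sinh x ^ 2 + 1 := Real.cosh_sq x
  unfold fH
  rw [hsq]
  have hu2 : (1 / Real.cosh x) ^ 2 * Real.cosh x ^ 2 = 1 := by field_simp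
  set u := (1 / Real.cosh x) ^ 2 with hu
  have f1 := fF_ge ha hac hc hm.1.le hm.2
  have hf : 0 < fF a c u := by linarith
  have dF := (fF_hasDeriv ha hac hc u (abs_lt_of hm.1.le hm.2)).comp x du
  have dF' := (fF_hasDeriv ha hac hc (1 - u) (abs_lt_of (by linarith [hm.2]) (by linarith [hm.1]))).comp x (du.const_sub 1)
  have := (dF'.div dF hf.ne').const_mul (betaB a (c - a) / 2)
  have hfun : ff a c = fun y => betaB a (c - a) / 2 *
    (((fF a c) ∘ fun x => 1 - (1 / Real.cosh x) ^ 2) / ((fF a c) ∘ fun x => (1 / Real.cosh x) ^ 2)) y := by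
    ext y; rw [ff_eq]; rfl
  rw [hfun]
  refine this.congr_deriv ?_
  simp only [Function.comp, sub_sub_cancel]
  rw [← hu]
  have hv : 0 < 1 - u := by linarith [hm.2]
  have hu0 : 0 < u := hm.1
  have hc2 : u = 1 / Real.cosh x ^ 2 := by rw [hu]; field_simp
  have hs2 : 1 - u = Real.sinh x ^ 2 / Real.cosh x ^ 2 := by
    rw [hc2]; field_simp; linarith
  unfold fN
  generalize fF a c u = X at *
  generalize fF a c (1 - u) = Y at *
  generalize fQ a c u = Z at *
  generalize fQ a c (1 - u) = W at *
  rw [hs2, hc2]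
  field_simp
  ring

lemma ff_pos (ha : 0 < a) (hac : a < c) (hc : c ≤ 1) {x : ℝ} (hx : 0 < x) : 0 < ff a c x := by
  have hm := sech_mem hx
  rw [ff_eq]
  have hB := betaB_pos ha hac
  have f1 := fF_ge ha hac hc hm.1.le hm.2
  have f2 := fF_ge ha hac hc (x := 1 - (1 / Real.cosh x) ^ 2) (by linarith [hm.2]) (by linarith [hm.1])
  have : 0 < fF a c ((1 / Real.cosh x) ^ 2) := by linarith
  have : 0 < fF a c (1 - (1 / Real.cosh x) ^ 2) := by linarith
  positivity

lemma ff_cont (ha : 0 < a) (hac : a < c) (hc : c ≤ 1) : ContinuousOn (ff a c) (Set.Ioi 0) :=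
  fun _ hx => (ff_hasDeriv ha hac hc hx).continuousAt.continuousWithinAt

lemma ff_mono (ha : 0 < a) (hac : a < c) (hc : c ≤ 1) : StrictMonoOn (ff a c) (Set.Ioi 0) := by
  refine strictMonoOn_of_deriv_pos (convex_Ioi _) (ff_cont ha hac hc) ?_
  rw [interior_Ioi]
  intro x hx
  rw [(ff_hasDeriv ha hac hc hx).deriv]
  have hm := sech_mem hx
  have f1 := fF_ge ha hac hc hm.1.le hm.2
  have : 0 < fF a c ((1 / Real.cosh x) ^ 2) := by linarith
  have hs : 0 < √(1 - (1 / Real.cosh x) ^ 2) := Real.sqrt_pos.2 (by linarith [hm.2])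
  have := fN_pos ha hac hc hm.1 hm.2
  have := betaB_pos ha hac
  unfold fH
  positivity

lemma ff_concave (ha : 0 < a) (hac : a < c) (hc : c ≤ 1) :
    StrictConcaveOn ℝ (Set.Ioi 0) (ff a c) := by
  refine StrictAntiOn.strictConcaveOn_of_deriv (convex_Ioi _) (ff_cont ha hac hc) ?_
  rw [interior_Ioi]
  intro x hx y hy hxy
  rw [(ff_hasDeriv ha hac hc hx).deriv, (ff_hasDeriv ha hac hc hy).deriv]
  refine mul_lt_mul_of_pos_left ?_ (betaB_pos ha hac)
  refine fH_strictMono ha hac hc (sech_mem hy) (sech_mem hx) ?_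
  have : Real.cosh x < Real.cosh y := by
    rw [Real.cosh_lt_cosh, abs_of_pos hx, abs_of_pos hy]; exact hxy
  have := Real.cosh_pos x
  gcongr
end

section
variable {a c : ℝ}

lemma g_large (ha : 0 < a) (hac : a < c) (hc : c ≤ 1) (M : ℝ) (hM : 0 < M) :
    ∃ u ∈ Set.Ioo (0:ℝ) 1, M < fF a c (1 - u) / fF a c u := by
  have hcp : 0 < c := by linarith
  have hk : 0 < a * (c - a) / c := div_pos (mul_pos ha (by linarith)) hcp
  set k := a * (c - a) / c with hkk
  have h1 : ∀ᶠ u in nhdsWithin (0:ℝ) (Set.Ioi 0), fF a c u < 2 := by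
    have hcn := (fF_hasDeriv ha hac hc 0 (by simp)).continuousAt
    refine Filter.Eventually.filter_mono nhdsWithin_le_nhds ?_
    refine hcn.eventually_lt_const ?_
    rw [fF_zero]; norm_num
  have h2 : ∀ᶠ u in nhdsWithin (0:ℝ) (Set.Ioi 0), Real.log u < -(2 * M / k) :=
    Real.tendsto_log_nhdsGT_zero.eventually_lt_atBot _
  have h3 : ∀ᶠ u in nhdsWithin (0:ℝ) (Set.Ioi 0), u ∈ Set.Ioo (0:ℝ) 1 :=
    Ioo_mem_nhdsGT one_pos
  obtain ⟨u, h1, h2, h3⟩ := (h1.and (h2.and h3)).exists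
  refine ⟨u, h3, ?_⟩
  have f1 := fF_ge ha hac hc h3.1.le h3.2
  rw [lt_div_iff₀ (by linarith)]
  have hl := fF_log ha hac hc (x := 1 - u) (by linarith [h3.2]) (by linarith [h3.1])
  rw [sub_sub_cancel, ← hkk] at hl
  have : 2 * M < k * (- Real.log u) := by
    have h4 : 2 * M / k < - Real.log u := by linarith
    rw [div_lt_iff₀ hk] at h4
    linarith
  nlinarith

lemma exists_x {r : ℝ} (hr : r ∈ Set.Ioo (0:ℝ) 1) :
    ∃ x, 0 < x ∧ r = 1 / Real.cosh x ∧ √(1 - r ^ 2) = Real.sinh x / Real.cosh x := by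
  have h1 : 1 < 1 / r := by rw [lt_div_iff₀ hr.1]; linarith [hr.2]
  have hx := Real.arcosh_pos h1
  have hcosh := Real.cosh_arcosh h1.le
  set x := Real.arcosh (1 / r)
  have e : r = 1 / Real.cosh x := by rw [hcosh]; simp
  refine ⟨x, hx, e, ?_⟩
  have hc := Real.cosh_pos x
  have hs := Real.sinh_pos_iff.2 hx
  rw [e, show 1 - (1 / Real.cosh x) ^ 2 = (Real.sinh x / Real.cosh x) ^ 2 by
      have := Real.cosh_sq x
      field_simp
      linarith]
  exact Real.sqrt_sq (by positivity)

lemma ff_at (a c : ℝ) {u : ℝ} (hu : u ∈ Set.Ioo (0:ℝ) 1) :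
    ∃ x, 0 < x ∧ ff a c x = betaB a (c - a) / 2 * (fF a c (1 - u) / fF a c u) := by
  obtain ⟨x, hx, e, _⟩ := exists_x (r := √u) ⟨Real.sqrt_pos.2 hu.1, by
    rw [Real.sqrt_lt' one_pos]; linarith [hu.2]⟩
  refine ⟨x, hx, ?_⟩
  rw [ff_eq, ← e, Real.sq_sqrt hu.1.le]

lemma ff_image (ha : 0 < a) (hac : a < c) (hc : c ≤ 1) : ff a c '' (Set.Ioi 0) = Set.Ioi 0 := by
  apply Set.Subset.antisymm
  · rintro _ ⟨x, hx, rfl⟩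
    exact ff_pos ha hac hc hx
  · intro y hy
    have hy : 0 < y := hy
    have hB := betaB_pos ha hac
    set B := betaB a (c - a) / 2 with hBB
    have hB2 : 0 < B := by positivity
    obtain ⟨u, hu, hul⟩ := g_large ha hac hc (y / B) (by positivity)
    obtain ⟨v, hv, hvl⟩ := g_large ha hac hc (B / y) (by positivity)
    obtain ⟨x1, hx1, e1⟩ := ff_at a c hu
    obtain ⟨x2, hx2, e2⟩ := ff_at a c (u := 1 - v) ⟨by linarith [hv.2], by linarith [hv.1]⟩
    rw [← hBB] at e1 e2
    rw [sub_sub_cancel] at e2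
    have f1 := fF_ge ha hac hc hv.1.le hv.2
    have f2 := fF_ge ha hac hc (x := 1 - v) (by linarith [hv.2]) (by linarith [hv.1])
    refine (isPreconnected_Ioi.intermediate_value (a := x2) (b := x1) hx2 hx1 (ff_cont ha hac hc)) ⟨?_, ?_⟩
    · rw [e2]
      rw [div_lt_div_iff₀ hy (by linarith)] at hvl
      rw [← mul_div_assoc, div_le_iff₀ (by linarith)]
      linarith
    · rw [e1]
      rw [div_lt_iff₀ hB2] at hul
      linarith

lemma ff_sub (ha : 0 < a) (hac : a < c) (hc : c ≤ 1) {x y : ℝ} (hx : 0 < x) (hy : 0 < y) :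
    x * ff a c (x + y) ≤ (x + y) * ff a c x := by
  have hcv := (ff_concave ha hac hc).concaveOn
  have key : ∀ ε ∈ Set.Ioo 0 x, (x - ε) * ff a c (x + y) ≤ (x + y - ε) * ff a c x := by
    intro ε hε
    have hd : 0 < x + y - ε := by linarith [hε.2]
    have w1 : 0 ≤ y / (x + y - ε) := by positivity
    have w2 : 0 ≤ (x - ε) / (x + y - ε) := div_nonneg (by linarith [hε.2]) hd.le
    have w3 : y / (x + y - ε) + (x - ε) / (x + y - ε) = 1 := by field_simp; ring
    have m1 : ε ∈ Set.Ioi (0:ℝ) := hε.1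
    have m2 : x + y ∈ Set.Ioi (0:ℝ) := add_pos hx hy
    have h := hcv.2 m1 m2 w1 w2 w3
    simp only [smul_eq_mul] at h
    rw [show y / (x + y - ε) * ε + (x - ε) / (x + y - ε) * (x + y) = x by field_simp; ring] at h
    have h0 : 0 < y / (x + y - ε) * ff a c ε := mul_pos (by positivity) (ff_pos ha hac hc hε.1)
    have h2 : (x - ε) / (x + y - ε) * ff a c (x + y) ≤ ff a c x := by linarith
    rw [div_mul_eq_mul_div, div_le_iff₀ hd] at h2
    linarith
  have t1 : Filter.Tendsto (fun ε : ℝ => (x - ε) * ff a c (x + y)) (nhdsWithin 0 (Set.Ioi 0))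
      (nhds ((x - 0) * ff a c (x + y))) :=
    (Continuous.tendsto (by fun_prop) 0).mono_left nhdsWithin_le_nhds
  have t2 : Filter.Tendsto (fun ε : ℝ => (x + y - ε) * ff a c x) (nhdsWithin 0 (Set.Ioi 0))
      (nhds ((x + y - 0) * ff a c x)) :=
    (Continuous.tendsto (by fun_prop) 0).mono_left nhdsWithin_le_nhds
  have := le_of_tendsto_of_tendsto t1 t2 (by
    filter_upwards [Ioo_mem_nhdsGT hx] with ε hε using key ε hε)
  simpa using this

lemma ff_subadd (ha : 0 < a) (hac : a < c) (hc : c ≤ 1) {x y : ℝ} (hx : 0 < x) (hy : 0 < y) :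
    ff a c (x + y) ≤ ff a c x + ff a c y := by
  have h1 := ff_sub ha hac hc hx hy
  have h2 := ff_sub ha hac hc hy hx
  rw [add_comm y x] at h2
  have : (x + y) * ff a c (x + y) ≤ (x + y) * (ff a c x + ff a c y) := by linarith
  exact le_of_mul_le_mul_left this (by linarith)

lemma mu_anti (ha : 0 < a) (hac : a < c) (hc : c ≤ 1) {r s : ℝ} (hr : r ∈ Set.Ioo (0:ℝ) 1)
    (hs : s ∈ Set.Ioo (0:ℝ) 1) (h : r ≤ s) : muAC a c s ≤ muAC a c r := by
  obtain ⟨x, hx, rfl, _⟩ := exists_x hr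
  obtain ⟨y, hy, rfl, _⟩ := exists_x hs
  refine (ff_mono ha hac hc).monotoneOn (a := y) (b := x) hy hx ?_
  have := Real.cosh_pos x
  have := Real.cosh_pos y
  rw [one_div_le_one_div (by positivity) (by positivity), Real.cosh_le_cosh, abs_of_pos hx,
    abs_of_pos hy] at h
  exact h

end

theorem stmt18 (a c : ℝ) (ha : 0 < a) (hac : a < c) (hc : c ≤ 1) :
    (StrictMonoOn (fun x : ℝ => muAC a c (1 / Real.cosh x)) (Set.Ioi 0) ∧
      ConcaveOn ℝ (Set.Ioi 0) (fun x : ℝ => muAC a c (1 / Real.cosh x)) ∧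
      (fun x : ℝ => muAC a c (1 / Real.cosh x)) '' (Set.Ioi 0) = Set.Ioi 0) ∧
    ∀ r s : ℝ, r ∈ Set.Ioo (0:ℝ) 1 → s ∈ Set.Ioo (0:ℝ) 1 →
      muAC a c (r * s / (1 + Real.sqrt (1 - r ^ 2) * Real.sqrt (1 - s ^ 2))) ≤
        muAC a c r + muAC a c s ∧
      muAC a c r + muAC a c s ≤
        2 * muAC a c (Real.sqrt (2 * r * s /
          (1 + r * s + Real.sqrt (1 - r ^ 2) * Real.sqrt (1 - s ^ 2)))) ∧
      2 * muAC a c (Real.sqrt (2 * r * s /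
          (1 + r * s + Real.sqrt (1 - r ^ 2) * Real.sqrt (1 - s ^ 2)))) ≤
        2 * muAC a c (Real.sqrt (r * s)) ∧
      (muAC a c r + muAC a c s =
          2 * muAC a c (Real.sqrt (2 * r * s /
            (1 + r * s + Real.sqrt (1 - r ^ 2) * Real.sqrt (1 - s ^ 2)))) ↔ r = s) := by

  refine ⟨⟨ff_mono ha hac hc, (ff_concave ha hac hc).concaveOn, ff_image ha hac hc⟩, ?_⟩
  intro r s hr hs
  obtain ⟨x, hx, er, er'⟩ := exists_x hr
  obtain ⟨y, hy, es, es'⟩ := exists_x hs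
  have hcx := Real.cosh_pos x
  have hcy := Real.cosh_pos y
  have hsx := Real.sinh_pos_iff.2 hx
  have hsy := Real.sinh_pos_iff.2 hy
  have hcxy := Real.cosh_add x y
  have hhalf : Real.cosh (x + y) = 2 * Real.cosh ((x + y) / 2) ^ 2 - 1 := by
    have := Real.cosh_two_mul ((x + y) / 2)
    rw [mul_div_cancel₀ _ (two_ne_zero)] at this
    rw [this, Real.sinh_sq]; ring
  have hch := Real.cosh_pos ((x + y) / 2)
  have E1 : r * s / (1 + √(1 - r ^ 2) * √(1 - s ^ 2)) = 1 / Real.cosh (x + y) := by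
    rw [er', es', er, es, hcxy]
    field_simp
  have E2 : √(2 * r * s / (1 + r * s + √(1 - r ^ 2) * √(1 - s ^ 2)))
      = 1 / Real.cosh ((x + y) / 2) := by
    have : 2 * r * s / (1 + r * s + √(1 - r ^ 2) * √(1 - s ^ 2))
      = (1 / Real.cosh ((x + y) / 2)) ^ 2 := by
      rw [er', es', er, es]
      have e3 : Real.cosh ((x + y) / 2) ^ 2 =
        (Real.cosh x * Real.cosh y + Real.sinh x * Real.sinh y + 1) / 2 := by linarith
      rw [div_pow, e3]
      field_simp
      ring
    rw [this, Real.sqrt_sq (by positivity)]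
  have Er : muAC a c r = ff a c x := by rw [er]; rfl
  have Es : muAC a c s = ff a c y := by rw [es]; rfl
  have E1' : muAC a c (r * s / (1 + √(1 - r ^ 2) * √(1 - s ^ 2))) = ff a c (x + y) := by
    rw [E1]; rfl
  have E2' : muAC a c (√(2 * r * s / (1 + r * s + √(1 - r ^ 2) * √(1 - s ^ 2))))
      = ff a c ((x + y) / 2) := by rw [E2]; rfl
  have strict : x ≠ y → ff a c x + ff a c y < 2 * ff a c ((x + y) / 2) := by
    intro hne
    have w1 : (0:ℝ) < 1 / 2 := by norm_num
    have w3 : (1:ℝ) / 2 + 1 / 2 = 1 := by norm_num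
    have m1 : x ∈ Set.Ioi (0:ℝ) := hx
    have m2 : y ∈ Set.Ioi (0:ℝ) := hy
    have := (ff_concave ha hac hc).2 m1 m2 hne w1 w1 w3
    simp only [smul_eq_mul] at this
    rw [show 1 / 2 * x + 1 / 2 * y = (x + y) / 2 by ring] at this
    linarith
  have heq : x = y → ff a c x + ff a c y = 2 * ff a c ((x + y) / 2) := by
    rintro rfl
    rw [add_self_div_two]; ring
  have h3 : muAC a c (√(2 * r * s / (1 + r * s + √(1 - r ^ 2) * √(1 - s ^ 2))))
      ≤ muAC a c (√(r * s)) := by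
    have hrs : 0 < r * s := mul_pos hr.1 hs.1
    refine mu_anti ha hac hc ⟨Real.sqrt_pos.2 hrs, ?_⟩ ?_ ?_
    · rw [Real.sqrt_lt' one_pos]; nlinarith [hr.1, hr.2, hs.1, hs.2]
    · rw [E2]
      refine ⟨by positivity, ?_⟩
      rw [div_lt_one hch]
      exact Real.one_lt_cosh.2 (by positivity)
    · apply Real.sqrt_le_sqrt
      have h1 : 0 ≤ 1 - r ^ 2 := by nlinarith [hr.1, hr.2]
      have h2 : 0 ≤ 1 - s ^ 2 := by nlinarith [hs.1, hs.2]
      have s1 := Real.sq_sqrt h1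
      have s2 := Real.sq_sqrt h2
      have p1 := Real.sqrt_nonneg (1 - r ^ 2)
      have p2 := Real.sqrt_nonneg (1 - s ^ 2)
      rw [le_div_iff₀ (by positivity)]
      have : 1 + r * s + √(1 - r ^ 2) * √(1 - s ^ 2) ≤ 2 := by
        linarith [sub_sq r s, sub_sq (√(1 - r ^ 2)) (√(1 - s ^ 2)),
          sq_nonneg (r - s), sq_nonneg (√(1 - r ^ 2) - √(1 - s ^ 2))]
      have := mul_le_mul_of_nonneg_left this hrs.le
      linarith
  refine ⟨?_, ?_, by linarith, ?_⟩
  · rw [E1', Er, Es]; exact ff_subadd ha hac hc hx hy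
  · rw [E2', Er, Es]
    by_cases h : x = y
    · exact (heq h).le
    · exact (strict h).le
  · rw [E2', Er, Es]
    constructor
    · intro h
      have : x = y := by
        by_contra hne
        exact (strict hne).ne h
      rw [er, es, this]
    · intro h
      apply heq
      rw [er, es] at h
      have h' : Real.cosh x = Real.cosh y := by
        field_simp at h
        exact h.symm
      rw [← Real.arcosh_cosh hx.le, ← Real.arcosh_cosh hy.le, h']
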